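/- Let k be a field, X a scheme separated and of finite type over k, and A_1, …, A_n closed irreducible J-linear subschemes of X such that for every nonempty subset I ⊆ {1, …, n} the intersection ⋂_{i∈I} A_i is irreducible and J-linear. Then the union ⋃_{i=1}^n A_i is J-linear. -/

import Mathlib

open AlgebraicGeometry CategoryTheory CategoryTheory.Limits

noncomputable section

/-- The base scheme `Spec k` of a field `k`. -/
def SpecOfField (k : Type) [Field k] : Scheme := Spec (CommRingCat.of k)

/-- Affine `N`-space `𝔸^N_k = Spec k[x₁, …, x_N]`, as a scheme over `Spec k`. -/
def AffineSpaceOver (k : Type) [Field k] (N : ℕ) : Over (SpecOfField k) :=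
  Over.mk (Spec.map (CommRingCat.ofHom (algebraMap k (MvPolynomial (Fin N) k))))

/-- `IsJLinear k n Y` says that the `k`-scheme `Y` is `n`-J-linear:
`Y` is `0`-J-linear if it is empty or isomorphic (as a `k`-scheme) to some `𝔸^N_k`, and
`Y` is `(n+1)`-J-linear if there is a triple `(Z, X, U)` with `Z ↪ X` a closed immersion
with open complement `U = X \ Z` such that either `Y = U` and both `Z` and `X` are
`n`-J-linear, or `Y = X` and both `Z` and `U` are `n`-J-linear. -/
inductive IsJLinear (k : Type) [Field k] : ℕ → Over (SpecOfField k) → Prop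
  | empty (Y : Over (SpecOfField k)) (h : IsEmpty Y.left.carrier) : IsJLinear k 0 Y
  | affine (Y : Over (SpecOfField k)) (N : ℕ) (h : Nonempty (Y ≅ AffineSpaceOver k N)) :
      IsJLinear k 0 Y
  | openCompl (n : ℕ) (Y Z X : Over (SpecOfField k)) (i : Z ⟶ X) (j : Y ⟶ X)
      (hi : IsClosedImmersion i.left) (hj : IsOpenImmersion j.left)
      (hcompl : Set.range j.left.base = (Set.range i.left.base)ᶜ)
      (hZ : IsJLinear k n Z) (hX : IsJLinear k n X) : IsJLinear k (n + 1) Y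
  | closedPart (n : ℕ) (Y Z U : Over (SpecOfField k)) (i : Z ⟶ Y) (j : U ⟶ Y)
      (hi : IsClosedImmersion i.left) (hj : IsOpenImmersion j.left)
      (hcompl : Set.range j.left.base = (Set.range i.left.base)ᶜ)
      (hZ : IsJLinear k n Z) (hU : IsJLinear k n U) : IsJLinear k (n + 1) Y

/-- A `k`-scheme is J-linear if it is `n`-J-linear for some `n ≥ 0`. -/
def IsJLinearScheme (k : Type) [Field k] (Y : Over (SpecOfField k)) : Prop :=
  ∃ n : ℕ, IsJLinear k n Y

/-- Every closed subset of a scheme carries a reduced closed subscheme structure. -/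
theorem exists_reduced_closed_subscheme (X : Scheme) (S : Set X) (hS : IsClosed S) :
    ∃ (R : Scheme) (r : R ⟶ X), IsReduced R ∧ IsClosedImmersion r ∧ Set.range r.base = S := by
  let I := Scheme.IdealSheafData.vanishingIdeal (X := X) ⟨S, hS⟩
  refine ⟨I.subscheme, I.subschemeι, ?_, inferInstance, ?_⟩
  · have (U : I.subschemeCover.openCover.I₀) : IsReduced (I.subschemeCover.openCover.X U) :=
      (affine_isReduced_iff _).2 ((Ideal.isRadical_iff_quotient_reduced _).1
        (PrimeSpectrum.isRadical_vanishingIdeal _))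
    exact IsReduced.of_openCover _ I.subschemeCover.openCover
  · exact I.range_subschemeι.trans (Scheme.IdealSheafData.coe_support_vanishingIdeal _)

/-- A morphism from a reduced scheme factors through a closed immersion as soon as it does so
set-theoretically. -/
theorem exists_lift_of_range_subset {T X Y : Scheme} [IsReduced T] (f : T ⟶ X) (i : Y ⟶ X)
    [IsClosedImmersion i] (h : Set.range f.base ⊆ Set.range i.base) : ∃ g : T ⟶ Y, g ≫ i = f := by
  have : Surjective (pullback.fst f i) := by
    rw [surjective_iff, ← Set.range_eq_univ, Scheme.Pullback.range_fst]
    exact Set.eq_univ_of_forall fun x ↦ h ⟨x, rfl⟩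
  have := isIso_of_isClosedImmersion_of_surjective (pullback.fst f i)
  exact ⟨inv (pullback.fst f i) ≫ pullback.snd f i, by simp [← pullback.condition]⟩

/-- A reduced closed subscheme `R` of an open subscheme `Y ⊆ X` is open in any reduced closed
subscheme `T` of `X` with the same trace on `Y`. -/
theorem exists_open_immersion_of_range_eq {R Y X T : Scheme} [IsReduced R] [IsReduced T]
    (r : R ⟶ Y) (j : Y ⟶ X) (t : T ⟶ X) [IsClosedImmersion r] [IsOpenImmersion j]
    [IsClosedImmersion t] (h : Set.range r.base = j.base ⁻¹' Set.range t.base) :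
    ∃ g : R ⟶ T, IsOpenImmersion g ∧ g ≫ t = r ≫ j := by
  have : IsReduced (pullback j t) := isReduced_of_isOpenImmersion (pullback.snd j t)
  have hfst : Set.range (pullback.fst j t).base = Set.range r.base :=
    (Scheme.Pullback.range_fst j t).trans h.symm
  obtain ⟨g, hg⟩ := exists_lift_of_range_subset r (pullback.fst j t) hfst.ge
  have : IsClosedImmersion (g ≫ pullback.fst j t) := hg ▸ inferInstance
  have : IsClosedImmersion g := .of_comp_isClosedImmersion g (pullback.fst j t)
  have : Surjective g := by
    refine (surjective_iff g).2 fun p ↦ ?_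
    obtain ⟨x, hx⟩ := hfst.le ⟨p, rfl⟩
    refine ⟨x, (pullback.fst j t).isClosedEmbedding.injective ?_⟩
    rw [← Scheme.Hom.comp_apply, hg]
    exact hx
  have := isIso_of_isClosedImmersion_of_surjective g
  exact ⟨g ≫ pullback.snd j t, inferInstance, by rw [Category.assoc, ← pullback.condition, ← hg,
    Category.assoc]⟩

instance (k : Type) [Field k] (N : ℕ) : IsReduced (AffineSpaceOver k N).left :=
  inferInstanceAs (IsReduced (Spec (CommRingCat.of (MvPolynomial (Fin N) k))))

section

variable {k : Type} [Field k]

theorem exists_over_reduced_closed_subscheme (X : Over (SpecOfField k)) (S : Set X.left)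
    (hS : IsClosed S) : ∃ (R : Over (SpecOfField k)) (r : R ⟶ X),
      IsReduced R.left ∧ IsClosedImmersion r.left ∧ Set.range r.left.base = S := by
  obtain ⟨R, r, h⟩ := exists_reduced_closed_subscheme X.left S hS
  exact ⟨Over.mk (r ≫ X.hom), Over.homMk r, h⟩

theorem CategoryTheory.Over.exists_hom_of_comp_eq {S : Scheme} {R T X : Over S} (r : R ⟶ X) (t : T ⟶ X)
    (g : R.left ⟶ T.left) (h : g ≫ t.left = r.left) : ∃ g' : R ⟶ T, g'.left = g ∧ g' ≫ t = r := by
  have w : g ≫ T.hom = R.hom := by rw [← Over.w t, ← Over.w r, ← h, Category.assoc]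
  exact ⟨Over.homMk g w, rfl, by ext1; exact h⟩

/-- A reduced closed subscheme factors through every closed subscheme with larger support. -/
theorem exists_closed_immersion_of_range_subset {R T X : Over (SpecOfField k)} [IsReduced R.left]
    (r : R ⟶ X) (t : T ⟶ X) [IsClosedImmersion r.left] [IsClosedImmersion t.left]
    (h : Set.range r.left.base ⊆ Set.range t.left.base) :
    ∃ g : R ⟶ T, IsClosedImmersion g.left ∧ g ≫ t = r := by
  obtain ⟨g, hg⟩ := exists_lift_of_range_subset r.left t.left h
  have : IsClosedImmersion (g ≫ t.left) := hg ▸ inferInstance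
  have : IsClosedImmersion g := .of_comp_isClosedImmersion g t.left
  obtain ⟨g', rfl, hg'⟩ := Over.exists_hom_of_comp_eq r t g hg
  exact ⟨g', this, hg'⟩

theorem range_left_eq_preimage {R T X : Over (SpecOfField k)} {g : R ⟶ T} {t : T ⟶ X} {r : R ⟶ X}
    (h : g ≫ t = r) [IsClosedImmersion t.left] :
    Set.range g.left.base = t.left.base ⁻¹' Set.range r.left.base := by
  subst h
  have := t.left.isClosedEmbedding.injective
  ext x
  constructor
  · rintro ⟨y, rfl⟩
    exact ⟨y, by simp⟩
  · rintro ⟨y, hy⟩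
    exact ⟨y, this (by simpa using hy)⟩

theorem IsJLinear.of_isEmpty (n : ℕ) (Y : Over (SpecOfField k)) (h : IsEmpty Y.left.carrier) :
    IsJLinear k n Y := by
  induction n with
  | zero => exact .empty Y h
  | succ n ih =>
    exact .closedPart n Y Y Y (𝟙 Y) (𝟙 Y) (inferInstanceAs (IsClosedImmersion (𝟙 Y.left)))
      (inferInstanceAs (IsOpenImmersion (𝟙 Y.left))) (Set.ext fun x ↦ h.elim x) ih ih

theorem IsJLinear.succ {n : ℕ} {Y : Over (SpecOfField k)} (h : IsJLinear k n Y) :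
    IsJLinear k (n + 1) Y := by
  let U : Over (SpecOfField k) := Over.mk (Scheme.emptyTo _)
  have hU : IsEmpty U.left.carrier := inferInstanceAs (IsEmpty (∅ : Scheme))
  let j : U ⟶ Y := Over.homMk (Scheme.emptyTo _) (Scheme.empty_ext _ _)
  refine .closedPart n Y Y U (𝟙 Y) j (inferInstanceAs (IsClosedImmersion (𝟙 Y.left)))
    (inferInstanceAs (IsOpenImmersion (Scheme.emptyTo _))) ?_ h (.of_isEmpty n U hU)
  ext x
  simp

theorem IsJLinear.mono {m n : ℕ} (hmn : m ≤ n) {Y : Over (SpecOfField k)} (h : IsJLinear k m Y) :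
    IsJLinear k n Y := by
  induction hmn with
  | refl => exact h
  | step _ ih => exact ih.succ

theorem IsJLinearScheme.openCompl {Y Z X : Over (SpecOfField k)} (i : Z ⟶ X) (j : Y ⟶ X)
    [hi : IsClosedImmersion i.left] [hj : IsOpenImmersion j.left]
    (hcompl : Set.range j.left.base = (Set.range i.left.base)ᶜ)
    (hZ : IsJLinearScheme k Z) (hX : IsJLinearScheme k X) : IsJLinearScheme k Y := by
  obtain ⟨m, hZ⟩ := hZ
  obtain ⟨n, hX⟩ := hX
  exact ⟨_, .openCompl (max m n) Y Z X i j hi hj hcompl (hZ.mono (le_max_left _ _))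
    (hX.mono (le_max_right _ _))⟩

theorem IsJLinearScheme.closedPart {Y Z U : Over (SpecOfField k)} (i : Z ⟶ Y) (j : U ⟶ Y)
    [hi : IsClosedImmersion i.left] [hj : IsOpenImmersion j.left]
    (hcompl : Set.range j.left.base = (Set.range i.left.base)ᶜ)
    (hZ : IsJLinearScheme k Z) (hU : IsJLinearScheme k U) : IsJLinearScheme k Y := by
  obtain ⟨m, hZ⟩ := hZ
  obtain ⟨n, hU⟩ := hU
  exact ⟨_, .closedPart (max m n) Y Z U i j hi hj hcompl (hZ.mono (le_max_left _ _))
    (hU.mono (le_max_right _ _))⟩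

/-- J-linearity passes to the reduction. -/
theorem IsJLinear.of_reduced {n : ℕ} {Y : Over (SpecOfField k)} (hY : IsJLinear k n Y)
    {R : Over (SpecOfField k)} (r : R ⟶ Y) [IsReduced R.left] [IsClosedImmersion r.left]
    [Surjective r.left] : IsJLinear k n R := by
  induction hY generalizing R with
  | empty Y h => exact .empty R (Function.isEmpty r.left.base)
  | affine Y N h =>
    obtain ⟨e⟩ := h
    let e' : Y.left ≅ (AffineSpaceOver k N).left := (Over.forget _).mapIso e
    have : IsReduced Y.left := isReduced_of_isOpenImmersion e'.hom
    have := isIso_of_isClosedImmersion_of_surjective r.left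
    have : IsIso ((Over.forget _).map r) := this
    have := isIso_of_reflects_iso r (Over.forget _)
    exact .affine R N ⟨asIso r ≪≫ e⟩
  | openCompl n Y Z X i j hi hj hcompl hZ hX ihZ ihX =>
    obtain ⟨X', x, _, _, hx⟩ := exists_over_reduced_closed_subscheme X Set.univ isClosed_univ
    obtain ⟨Z', z, _, _, hz⟩ := exists_over_reduced_closed_subscheme Z Set.univ isClosed_univ
    have hxs : Surjective x.left := (surjective_iff _).2 (Set.range_eq_univ.1 hx)
    have hzs : Surjective z.left := (surjective_iff _).2 (Set.range_eq_univ.1 hz)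
    have : IsClosedImmersion (z ≫ i).left := inferInstanceAs (IsClosedImmersion (z.left ≫ i.left))
    obtain ⟨i', _, hi'⟩ := exists_closed_immersion_of_range_subset (z ≫ i) x (by simp [hx])
    obtain ⟨j', hj', e⟩ := exists_open_immersion_of_range_eq r.left j.left x.left
      (by simp [hx, Set.range_eq_univ.2 r.left.surjective])
    obtain ⟨j', rfl, hjr⟩ := Over.exists_hom_of_comp_eq (r ≫ j) x j' e
    refine .openCompl n R Z' X' i' j' ‹_› hj' ?_ (ihZ z) (ihX x)
    rw [range_left_eq_preimage hjr, range_left_eq_preimage hi', ← Set.preimage_compl]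
    congr 1
    have h₁ : Set.range (r ≫ j).left.base = Set.range j.left.base := by
      simpa using r.left.surjective.range_comp j.left.base
    have h₂ : Set.range (z ≫ i).left.base = Set.range i.left.base := by
      simpa using z.left.surjective.range_comp i.left.base
    rw [h₁, h₂, hcompl]
  | closedPart n Y Z U i j hi hj hcompl hZ hU ihZ ihU =>
    obtain ⟨Z', z, _, _, hz⟩ := exists_over_reduced_closed_subscheme Z Set.univ isClosed_univ
    have hzs : Surjective z.left := (surjective_iff _).2 (Set.range_eq_univ.1 hz)
    have : IsClosedImmersion (z ≫ i).left := inferInstanceAs (IsClosedImmersion (z.left ≫ i.left))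
    obtain ⟨i', _, hi'⟩ := exists_closed_immersion_of_range_subset (z ≫ i) r
      (by simp [Set.range_eq_univ.2 r.left.surjective])
    let U' : Over (SpecOfField k) := Over.mk (pullback.snd r.left j.left ≫ U.hom)
    let u : U' ⟶ U := Over.homMk (pullback.snd r.left j.left)
    let j' : U' ⟶ R := Over.homMk (pullback.fst r.left j.left) (by
      rw [← Over.w r, pullback.condition_assoc, Over.w j]; rfl)
    have hj' : IsOpenImmersion j'.left :=
      inferInstanceAs (IsOpenImmersion (pullback.fst r.left j.left))
    have : IsClosedImmersion u.left :=
      inferInstanceAs (IsClosedImmersion (pullback.snd r.left j.left))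
    have : Surjective u.left := inferInstanceAs (Surjective (pullback.snd r.left j.left))
    have : IsReduced U'.left := isReduced_of_isOpenImmersion j'.left
    refine .closedPart n R Z' U' i' j' ‹_› hj' ?_ (ihZ z) (ihU u)
    have h₂ : Set.range (z ≫ i).left.base = Set.range i.left.base := by
      simpa using z.left.surjective.range_comp i.left.base
    rw [range_left_eq_preimage hi', h₂, ← Set.preimage_compl, ← hcompl]
    exact Scheme.Pullback.range_fst r.left j.left

/-- The closed subset `S` of `X` underlies some J-linear closed subscheme. -/
def IsJLinearSet (X : Over (SpecOfField k)) (S : Set X.left) : Prop :=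
  ∃ (Y : Over (SpecOfField k)) (u : Y ⟶ X), IsClosedImmersion u.left ∧
    Set.range u.left.base = S ∧ IsJLinearScheme k Y

theorem IsJLinearSet.isClosed {X : Over (SpecOfField k)} {S : Set X.left}
    (h : IsJLinearSet X S) : IsClosed S := by
  obtain ⟨Y, u, _, rfl, -⟩ := h
  exact u.left.isClosedEmbedding.isClosed_range

theorem IsJLinearSet.exists_reduced {X : Over (SpecOfField k)} {S : Set X.left}
    (h : IsJLinearSet X S) : ∃ (R : Over (SpecOfField k)) (r : R ⟶ X), IsReduced R.left ∧
      IsClosedImmersion r.left ∧ Set.range r.left.base = S ∧ IsJLinearScheme k R := by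
  obtain ⟨R, r, _, _, hr⟩ := exists_over_reduced_closed_subscheme X S h.isClosed
  obtain ⟨Y, u, _, rfl, n, hn⟩ := h
  obtain ⟨g, _, hg⟩ := exists_closed_immersion_of_range_subset r u hr.le
  have : Surjective g.left := by
    refine (surjective_iff _).2 (Set.range_eq_univ.1 ?_)
    rw [range_left_eq_preimage hg, hr]
    exact Set.preimage_range _
  exact ⟨R, r, ‹_›, ‹_›, hr, n, hn.of_reduced g⟩

theorem isJLinearSet_empty (X : Over (SpecOfField k)) : IsJLinearSet X ∅ := by
  have : IsEmpty (∅ : Scheme).carrier := inferInstanceAs (IsEmpty (∅ : Scheme))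
  refine ⟨Over.mk (Scheme.emptyTo _), Over.homMk (Scheme.emptyTo _) (Scheme.empty_ext _ _),
    inferInstanceAs (IsClosedImmersion (Scheme.emptyTo _)), ?_, 0, .empty _ this⟩
  exact Set.range_eq_empty (ι := (∅ : Scheme).carrier) _

theorem IsJLinearSet.union {X : Over (SpecOfField k)} {S T : Set X.left} (hS : IsJLinearSet X S)
    (hT : IsJLinearSet X T) (hST : IsJLinearSet X (S ∩ T)) : IsJLinearSet X (S ∪ T) := by
  obtain ⟨W, w, _, _, hw⟩ :=
    exists_over_reduced_closed_subscheme X (S ∪ T) (hS.isClosed.union hT.isClosed)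
  let V : X.left.Opens := ⟨Tᶜ, hT.isClosed.isOpen_compl⟩
  have hV : Set.range V.ι.base = Tᶜ := Scheme.Opens.range_ι V
  obtain ⟨A, a, _, _, ha, hA⟩ := hS.exists_reduced
  obtain ⟨B, b, _, _, hb, hB⟩ := hT.exists_reduced
  obtain ⟨C, c, _, _, hc, hC⟩ := hST.exists_reduced
  obtain ⟨bw, _, hbw⟩ := exists_closed_immersion_of_range_subset b w (by simp [hb, hw])
  obtain ⟨ca, _, hca⟩ := exists_closed_immersion_of_range_subset c a (by simp [hc, ha])
  have : IsReduced (pullback V.ι a.left) :=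
    isReduced_of_isOpenImmersion (pullback.snd V.ι a.left)
  let U : Over (SpecOfField k) := Over.mk (pullback.snd V.ι a.left ≫ A.hom)
  let j : U ⟶ A := Over.homMk (pullback.snd V.ι a.left)
  have : IsOpenImmersion j.left :=
    inferInstanceAs (IsOpenImmersion (pullback.snd V.ι a.left))
  have hVS : V.ι.base ⁻¹' Set.range a.left.base = V.ι.base ⁻¹' Set.range w.left.base := by
    ext x
    have hx : V.ι.base x ∉ T := hV.le ⟨x, rfl⟩
    rw [ha, hw]
    simp [hx]
  obtain ⟨g, hg, e⟩ := exists_open_immersion_of_range_eq (pullback.fst V.ι a.left) V.ι w.left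
    ((Scheme.Pullback.range_fst V.ι a.left).trans hVS)
  obtain ⟨g, rfl, hgw⟩ := Over.exists_hom_of_comp_eq (j ≫ a) w g (e.trans pullback.condition)
  have hj : Set.range j.left.base = a.left.base ⁻¹' Tᶜ :=
    (Scheme.Pullback.range_snd V.ι a.left).trans (congrArg _ hV)
  have hU : IsJLinearScheme k U := by
    refine .openCompl ca j ?_ hC hA
    rw [hj, range_left_eq_preimage hca, hc, ← ha, Set.preimage_range_inter, Set.preimage_compl]
  refine ⟨W, w, ‹_›, hw, .closedPart bw g ?_ hB hU⟩
  rw [range_left_eq_preimage hgw, range_left_eq_preimage hbw, hb]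
  ext x
  have hx : w.left.base x ∈ S ∪ T := hw.le ⟨x, rfl⟩
  have hja : Set.range (j ≫ a).left.base = S ∩ Tᶜ := by
    have : Set.range (j ≫ a).left.base = a.left.base '' Set.range j.left.base := by
      simpa using Set.range_comp a.left.base j.left.base
    rw [this, hj, Set.image_preimage_eq_range_inter, ha]
  rw [hja]
  simp only [Set.mem_preimage, Set.mem_inter_iff, Set.mem_compl_iff, Set.mem_union] at hx ⊢
  tauto

/-- If `P` holds for `∅`, and for `S ∪ T` whenever it holds for `S`, `T` and `S ∩ T`, then it holds
for a finite union all of whose nonempty partial intersections satisfy it. -/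
theorem Finset.biUnion_induction_of_inter {ι α : Type*} {P : Set α → Prop} (empty : P ∅)
    (union : ∀ S T, P S → P T → P (S ∩ T) → P (S ∪ T)) (s : Finset ι) (S : ι → Set α)
    (inter : ∀ J ⊆ s, J.Nonempty → P (⋂ i ∈ J, S i)) : P (⋃ i ∈ s, S i) := by
  classical
  induction s using Finset.induction_on generalizing S with
  | empty => simpa using empty
  | insert a s ha ih =>
    rw [Finset.set_biUnion_insert, Set.union_comm]
    refine union _ _ (ih S fun J hJ ↦ inter J (hJ.trans (Finset.subset_insert a s))) ?_ ?_
    · simpa using inter {a} (by simp) (by simp)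
    · rw [Set.iUnion₂_inter]
      refine ih _ fun J hJ hne ↦ ?_
      have := inter (insert a J) (Finset.insert_subset_insert a hJ) (by simp)
      rw [Finset.set_biInter_insert] at this
      convert this using 1
      obtain ⟨b, hb⟩ := hne
      ext x
      simp only [Set.mem_iInter, Set.mem_inter_iff]
      exact ⟨fun h ↦ ⟨(h b hb).2, fun i hi ↦ (h i hi).1⟩, fun h i hi ↦ ⟨h.2 i hi, h.1⟩⟩

end

/-- Let `X` be a scheme, separated and of finite type over a field `k`, and
let `A 1, …, A n` be closed irreducible J-linear subschemes of `X` (given by closed immersions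
`a i : A i ⟶ X` of `k`-schemes) such that for every nonempty subset `J ⊆ {1, …, n}` the
intersection `⋂ i ∈ J, A i` (given as a closed subscheme `B J` of `X` with underlying set
`⋂ i ∈ J, im (a i)`) is irreducible and J-linear. Then the union `⋃ i, A i` is a J-linear
closed subscheme of `X`. -/
theorem isJLinearScheme_union_of_closed_irreducible (k : Type) [Field k]
    (X : Over (SpecOfField k)) [IsSeparated X.hom] [LocallyOfFiniteType X.hom]
    [QuasiCompact X.hom]
    (n : ℕ) (A : Fin n → Over (SpecOfField k)) (a : ∀ i, A i ⟶ X)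
    (ha : ∀ i, IsClosedImmersion (a i).left)
    (hAirr : ∀ i, IrreducibleSpace (A i).left.carrier)
    (hAlin : ∀ i, IsJLinearScheme k (A i))
    (B : Finset (Fin n) → Over (SpecOfField k)) (b : ∀ J, B J ⟶ X)
    (hb : ∀ J : Finset (Fin n), J.Nonempty → IsClosedImmersion (b J).left)
    (hbrange : ∀ J : Finset (Fin n), J.Nonempty →
      Set.range (b J).left.base = ⋂ i ∈ J, Set.range (a i).left.base)
    (hBirr : ∀ J : Finset (Fin n), J.Nonempty → IrreducibleSpace (B J).left.carrier)
    (hBlin : ∀ J : Finset (Fin n), J.Nonempty → IsJLinearScheme k (B J)) :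
    ∃ (Y : Over (SpecOfField k)) (u : Y ⟶ X), IsClosedImmersion u.left ∧
      Set.range u.left.base = (⋃ i, Set.range (a i).left.base) ∧
      IsJLinearScheme k Y := by
  have := Finset.biUnion_induction_of_inter (isJLinearSet_empty X)
    (fun _ _ hS hT ↦ hS.union hT) Finset.univ (fun i ↦ Set.range (a i).left.base)
    fun J _ hJ ↦ ⟨B J, b J, hb J hJ, hbrange J hJ, hBlin J hJ⟩
  simpa [IsJLinearSet] using this
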